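/- Let F₁, …, Fₙ be regular cdfs on [0,∞) with densities and finite expectations, with virtual values ψ₁, …, ψₙ. Let X₁, …, Xₙ be independent with Xᵢ ∼ Fᵢ, and let Y₁, …, Yₙ be independent copies (Yᵢ ∼ Fᵢ, independent of everything else). Then the second-price auction without reserve run on the 2n bidders {X₁, …, Xₙ, Y₁, …, Yₙ} is a 2-approximation of the Myerson auction on the n original bidders: E[ second-highest of (X₁, …, Xₙ, Y₁, …, Yₙ) ] ≥ (1/2) · E[ max(0, maxᵢ ψᵢ(Xᵢ)) ]. -/

import Mathlib

open MeasureTheory Set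

/-- The probability measure of a bidder whose value has density `f` on `[0,∞)`. -/
noncomputable def valueMeasure (f : ℝ → ℝ) : Measure ℝ :=
  (volume.restrict (Ici 0)).withDensity fun x => ENNReal.ofReal (f x)

/-- The second-highest of at least two values indexed by a finite type. -/
noncomputable def secondHighest {ι : Type*} [Fintype ι] [DecidableEq ι]
    (h : 2 ≤ Fintype.card ι) (x : ι → ℝ) : ℝ :=
  Finset.univ.sup'
    (Finset.univ_nonempty_iff.mpr (Fintype.card_pos_iff.mp (by omega)))
    fun i =>
      min (x i)
        ((Finset.univ.erase i).sup'
          (by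
            rw [← Finset.card_pos, Finset.card_erase_of_mem (Finset.mem_univ i),
              Finset.card_univ]
            omega)
          x)

/-- Real one-dimensional inequality. -/
theorem oneDim_aux (F f ψ : ℝ → ℝ) (hf : Continuous f) (hpos : ∀ x, 0 ≤ x → 0 < f x)
    (hF : ∀ x, F x = ∫ t in (0:ℝ)..x, f t)
    (hψ : ∀ x, ψ x = x - (1 - F x) / f x)
    (hreg : StrictMonoOn ψ (Ici 0))
    (hF1 : ∀ x, 0 ≤ x → F x ≤ 1) (t T : ℝ) (ht : 0 ≤ t) (htT : t ≤ T) :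
    ∫ x in t..T, max 0 (ψ x) * F x * f x
      ≤ 2 * ∫ y in (0:ℝ)..T, (max y t * (1 - F (max y t))) * f y := by
  have hFeq : F = fun x => ∫ t in (0:ℝ)..x, f t := funext hF
  have hFd : ∀ x, HasDerivAt F (f x) x := by
    intro x
    rw [hFeq]
    exact intervalIntegral.integral_hasDerivAt_right (hf.intervalIntegrable _ _)
      (hf.stronglyMeasurableAtFilter _ _) hf.continuousAt
  have hFc : Continuous F := continuous_iff_continuousAt.2 fun x => (hFd x).continuousAt
  have hF0 : F 0 = 0 := by rw [hF]; simp
  have hFnn : ∀ x, 0 ≤ x → 0 ≤ F x := by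
    intro x hx
    rw [hF]
    exact intervalIntegral.integral_nonneg hx fun u hu => (hpos u hu.1).le
  have hψc : ContinuousOn ψ (Ici 0) := by
    have : ψ = fun x => x - (1 - F x) / f x := funext hψ
    rw [this]
    exact continuousOn_id.sub (((continuous_const.sub hFc).continuousOn).div hf.continuousOn
      fun x hx => (hpos x hx).ne')
  have hψf : ∀ x, 0 ≤ x → ψ x * f x = x * f x - (1 - F x) := by
    intro x hx
    have := (hpos x hx).ne'
    rw [hψ]; field_simp
  have hH : ∀ x, HasDerivAt (fun x => x * (1 - F x)) (1 * (1 - F x) + x * (- f x)) x := by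
    intro x
    have h1 : HasDerivAt (fun x => 1 - F x) (- f x) x := by
      simpa using (hFd x).const_sub 1
    exact (hasDerivAt_id x).mul h1
  -- key inequality from regularity
  have key : ∀ s, 0 ≤ s → 0 ≤ s * (1 - F s) + ψ s * F s := by
    intro s hs
    have hk : ∀ x, HasDerivAt (fun x => x * (1 - F x) + ψ s * F x)
        (1 * (1 - F x) + x * (- f x) + ψ s * f x) x := fun x =>
      (hH x).add ((hFd x).const_mul (ψ s))
    have hmono : MonotoneOn (fun x => x * (1 - F x) + ψ s * F x) (Icc 0 s) := by
      apply monotoneOn_of_deriv_nonneg (convex_Icc 0 s)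
      · exact (continuous_iff_continuousAt.2 fun x => (hk x).continuousAt).continuousOn
      · exact fun x _ => (hk x).differentiableAt.differentiableWithinAt
      · intro x hx
        rw [interior_Icc] at hx
        rw [(hk x).deriv]
        have h1 := hreg (mem_Ici.2 hx.1.le) (mem_Ici.2 hs) hx.2
        have h2 := hψf x hx.1.le
        have h3 := hpos x hx.1.le
        nlinarith
    have := hmono (left_mem_Icc.2 hs) (right_mem_Icc.2 hs) hs
    simpa [hF0] using this
  set g1 : ℝ → ℝ := fun y => (max y t * (1 - F (max y t))) * f y with hg1
  set g2 : ℝ → ℝ := fun x => max 0 (ψ x) * F x * f x with hg2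
  have hg1c : Continuous g1 := by rw [hg1]; fun_prop
  have hg2c : ContinuousOn g2 (Ici 0) :=
    ((continuousOn_const.sup hψc).mul hFc.continuousOn).mul hf.continuousOn
  have hg2i : ∀ a b, 0 ≤ a → 0 ≤ b → IntervalIntegrable g2 volume a b := by
    intro a b ha hb
    apply ContinuousOn.intervalIntegrable
    exact hg2c.mono fun x hx => le_trans (le_min ha hb) hx.1
  have hd1 : ∀ s, HasDerivAt (fun s => ∫ y in (0:ℝ)..s, g1 y) (g1 s) s := fun s =>
    intervalIntegral.integral_hasDerivAt_right (hg1c.intervalIntegrable _ _)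
      (hg1c.stronglyMeasurableAtFilter _ _) hg1c.continuousAt
  have hd2 : ∀ s, t < s → HasDerivAt (fun s => ∫ y in t..s, g2 y) (g2 s) s := by
    intro s hs
    have hs0 : 0 < s := ht.trans_lt hs
    refine intervalIntegral.integral_hasDerivAt_right (hg2i _ _ ht hs0.le) ?_ ?_
    · exact ContinuousOn.stronglyMeasurableAtFilter isOpen_Ioi
        (hg2c.mono Ioi_subset_Ici_self) s hs0
    · exact hg2c.continuousAt (Ici_mem_nhds hs0)
  have hd : ∀ s, t < s → HasDerivAt (fun s => 2 * (∫ y in (0:ℝ)..s, g1 y) - (∫ y in t..s, g2 y)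
      - F s * (s * (1 - F s))) (2 * g1 s - g2 s
        - (f s * (s * (1 - F s)) + F s * (1 * (1 - F s) + s * (- f s)))) s := by
    intro s hs
    exact (((hd1 s).const_mul 2).sub (hd2 s hs)).sub ((hFd s).mul (hH s))
  have hmono : MonotoneOn (fun s => 2 * (∫ y in (0:ℝ)..s, g1 y) - (∫ y in t..s, g2 y)
      - F s * (s * (1 - F s))) (Icc t T) := by
    apply monotoneOn_of_deriv_nonneg (convex_Icc t T)
    · have c1 : Continuous (fun s => ∫ y in (0:ℝ)..s, g1 y) :=
        continuous_iff_continuousAt.2 fun x => (hd1 x).continuousAt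
      have c2 : ContinuousOn (fun s => ∫ y in t..s, g2 y) (Icc t T) := by
        have := intervalIntegral.continuousOn_primitive_interval (f := g2) (μ := volume)
          (a := t) (b := T) ?_
        · rwa [uIcc_of_le htT] at this
        · rw [uIcc_of_le htT]
          exact (hg2c.mono fun x hx => ht.trans hx.1).integrableOn_Icc
      have c3 : Continuous (fun s => F s * (s * (1 - F s))) := by fun_prop
      exact ((continuous_const.mul c1).continuousOn.sub c2).sub c3.continuousOn
    · intro x hx
      rw [interior_Icc] at hx
      exact (hd x hx.1).differentiableAt.differentiableWithinAt
    · intro s hs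
      rw [interior_Icc] at hs
      rw [(hd s hs.1).deriv]
      have hs0 : 0 ≤ s := ht.trans hs.1.le
      have e1 : g1 s = s * (1 - F s) * f s := by
        simp only [hg1]; rw [max_eq_left hs.1.le]
      have e2 : g2 s = max 0 (ψ s) * F s * f s := rfl
      rw [e1, e2]
      have h2 := hψf s hs0
      have h3 := hpos s hs0
      have h4 := key s hs0
      have h5 := hFnn s hs0
      have h6 := hF1 s hs0
      have e3 : 2 * (s * (1 - F s) * f s) - max 0 (ψ s) * F s * f s
        - (f s * (s * (1 - F s)) + F s * (1 * (1 - F s) + s * (- f s)))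
        = f s * (s * (1 - F s) - max 0 (ψ s) * F s + ψ s * F s) := by
        linear_combination (- F s) * h2
      rw [e3]
      apply mul_nonneg h3.le
      rcases le_total 0 (ψ s) with h | h
      · rw [max_eq_right h]
        have := mul_nonneg hs0 (sub_nonneg.2 h6)
        linarith
      · rw [max_eq_left h]; linarith
  have hfin := hmono (left_mem_Icc.2 htT) (right_mem_Icc.2 htT) htT
  have e4 : ∫ y in (0:ℝ)..t, g1 y = (t * (1 - F t)) * F t := by
    conv_rhs => rw [show (t * (1 - F t)) * F t = (t * (1 - F t)) * ∫ u in (0:ℝ)..t, f u by rw [← hF t],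
      ← intervalIntegral.integral_const_mul]
    apply intervalIntegral.integral_congr
    intro y hy
    rw [uIcc_of_le ht] at hy
    simp only [hg1]; rw [max_eq_right hy.2]
  simp only [e4, intervalIntegral.integral_same] at hfin
  have p1 := mul_nonneg (hFnn t ht) (mul_nonneg ht (sub_nonneg.2 (hF1 t ht)))
  have p2 := mul_nonneg (hFnn T (ht.trans htT))
    (mul_nonneg (ht.trans htT) (sub_nonneg.2 (hF1 T (ht.trans htT))))
  linarith

theorem valueMeasure_Iio (F f : ℝ → ℝ) (hf : Continuous f) (hpos : ∀ x, 0 ≤ x → 0 < f x)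
    (hF : ∀ x, F x = ∫ t in (0:ℝ)..x, f t) (x : ℝ) (hx : 0 ≤ x) :
    valueMeasure f (Iio x) = ENNReal.ofReal (F x) := by
  rw [valueMeasure, withDensity_apply _ measurableSet_Iio,
    Measure.restrict_restrict measurableSet_Iio, hF, intervalIntegral.integral_of_le hx]
  have e : Iio x ∩ Ici 0 = Ico 0 x := by ext y; simp [and_comm]
  rw [e, integral_Ioc_eq_integral_Ioo, setLIntegral_congr (Ioo_ae_eq_Ico (a := (0:ℝ)) (b := x)).symm,
    ofReal_integral_eq_lintegral_ofReal]
  · exact (hf.integrableOn_Icc (a := 0) (b := x)).mono_set Ioo_subset_Icc_self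
  · filter_upwards [ae_restrict_mem measurableSet_Ioo] with y hy using (hpos y hy.1.le).le

theorem valueMeasure_cdf_le (F f : ℝ → ℝ) (hf : Continuous f) (hpos : ∀ x, 0 ≤ x → 0 < f x)
    (hF : ∀ x, F x = ∫ t in (0:ℝ)..x, f t) (hp : IsProbabilityMeasure (valueMeasure f))
    (x : ℝ) (hx : 0 ≤ x) : F x ≤ 1 := by
  have h := valueMeasure_Iio F f hf hpos hF x hx
  have h2 : ENNReal.ofReal (F x) ≤ 1 := h ▸ prob_le_one
  exact ENNReal.ofReal_le_one.1 h2

theorem valueMeasure_Ioi (F f : ℝ → ℝ) (hf : Continuous f) (hpos : ∀ x, 0 ≤ x → 0 < f x)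
    (hF : ∀ x, F x = ∫ t in (0:ℝ)..x, f t) (hp : IsProbabilityMeasure (valueMeasure f))
    (x : ℝ) (hx : 0 ≤ x) :
    valueMeasure f (Ioi x) = ENNReal.ofReal (1 - F x) := by
  have h := valueMeasure_Iio F f hf hpos hF x hx
  have hac : valueMeasure f ≪ volume :=
    (withDensity_absolutelyContinuous _ _).trans Measure.restrict_le_self.absolutelyContinuous
  have e : valueMeasure f (Iic x) = valueMeasure f (Iio x) :=
    measure_congr (hac.ae_eq Iio_ae_eq_Iic).symm
  have hFnn : 0 ≤ F x := by
    rw [hF]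
    exact intervalIntegral.integral_nonneg hx fun u hu => (hpos u hu.1).le
  rw [← compl_Iic, prob_compl_eq_one_sub measurableSet_Iic, e, h, ENNReal.ofReal_sub _ hFnn,
    ENNReal.ofReal_one]

theorem valueMeasure_ae_nonneg (f : ℝ → ℝ) : ∀ᵐ x ∂(valueMeasure f), 0 ≤ x :=
  (withDensity_absolutelyContinuous _ _) (ae_restrict_mem measurableSet_Ici)

theorem oneDim_lintegral (F f ψ : ℝ → ℝ) (hf : Continuous f) (hpos : ∀ x, 0 ≤ x → 0 < f x)
    (hF : ∀ x, F x = ∫ t in (0:ℝ)..x, f t)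
    (hψ : ∀ x, ψ x = x - (1 - F x) / f x)
    (hreg : StrictMonoOn ψ (Ici 0)) (hψm : Measurable ψ)
    (hp : IsProbabilityMeasure (valueMeasure f)) (t : ℝ) (ht : 0 ≤ t) :
    ∫⁻ p, (if max p.2 t < p.1 then ENNReal.ofReal (max 0 (ψ p.1)) else 0)
        ∂((valueMeasure f).prod (valueMeasure f))
      ≤ 2 * ∫⁻ p, (if max p.2 t < p.1 then ENNReal.ofReal (max p.2 t) else 0)
        ∂((valueMeasure f).prod (valueMeasure f)) := by
  have hF1 := valueMeasure_cdf_le F f hf hpos hF hp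
  have hFc : Continuous F := by
    rw [show F = _ from funext hF]
    exact intervalIntegral.continuous_primitive (fun a b => hf.intervalIntegrable a b) 0
  have hFnn : ∀ x, 0 ≤ x → 0 ≤ F x := by
    intro x hx
    rw [hF]
    exact intervalIntegral.integral_nonneg hx fun u hu => (hpos u hu.1).le
  have hset : MeasurableSet {p : ℝ × ℝ | max p.2 t < p.1} :=
    measurableSet_lt (by fun_prop) (by fun_prop)
  have hm1 : Measurable fun p : ℝ × ℝ =>
      (if max p.2 t < p.1 then ENNReal.ofReal (max 0 (ψ p.1)) else 0) :=
    Measurable.ite hset (by fun_prop) measurable_const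
  have hm2 : Measurable fun p : ℝ × ℝ =>
      (if max p.2 t < p.1 then ENNReal.ofReal (max p.2 t) else 0) :=
    Measurable.ite hset (by fun_prop) measurable_const
  have hLdens : ∀ g : ℝ → ENNReal, Measurable g → ∫⁻ x, g x ∂(valueMeasure f)
      = ∫⁻ x in Ici 0, ENNReal.ofReal (f x) * g x := by
    intro g hg
    rw [valueMeasure, lintegral_withDensity_eq_lintegral_mul _ (by fun_prop) hg]
    rfl
  rw [lintegral_prod _ hm1.aemeasurable, lintegral_prod_symm _ hm2.aemeasurable]
  have eL : ∀ x, ∫⁻ y, (if max y t < x then ENNReal.ofReal (max 0 (ψ x)) else 0)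
      ∂(valueMeasure f) = (Ioi t).indicator
        (fun x => ENNReal.ofReal (max 0 (ψ x)) * ENNReal.ofReal (F x)) x := by
    intro x
    by_cases hx : t < x
    · rw [indicator_of_mem (mem_Ioi.2 hx), ← valueMeasure_Iio F f hf hpos hF x (ht.trans hx.le),
        ← lintegral_indicator_const measurableSet_Iio]
      apply lintegral_congr
      intro y
      simp [indicator, hx]
    · rw [indicator_of_notMem (by simpa using hx)]
      simp [hx]
  have eR : ∀ y, ∫⁻ x, (if max y t < x then ENNReal.ofReal (max y t) else 0)
      ∂(valueMeasure f) = ENNReal.ofReal (max y t * (1 - F (max y t))) := by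
    intro y
    have h0 : 0 ≤ max y t := le_max_of_le_right ht
    rw [ENNReal.ofReal_mul h0, ← valueMeasure_Ioi F f hf hpos hF hp _ h0,
        ← lintegral_indicator_const measurableSet_Ioi]
    rfl
  simp only [eL, eR]
  rw [hLdens _ ?_, hLdens _ (by fun_prop)]
  rotate_left
  · exact Measurable.indicator (by fun_prop) measurableSet_Ioi
  have eL2 : ∫⁻ x in Ici 0, ENNReal.ofReal (f x) * (Ioi t).indicator
        (fun x => ENNReal.ofReal (max 0 (ψ x)) * ENNReal.ofReal (F x)) x
      = ∫⁻ x in Ioi t, ENNReal.ofReal (max 0 (ψ x) * F x * f x) := by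
    rw [← lintegral_indicator measurableSet_Ici, ← lintegral_indicator measurableSet_Ioi]
    apply lintegral_congr
    intro x
    by_cases hx : t < x
    · have hx0 : 0 ≤ x := ht.trans hx.le
      rw [indicator_of_mem (mem_Ici.2 hx0), indicator_of_mem (mem_Ioi.2 hx),
        indicator_of_mem (mem_Ioi.2 hx), ENNReal.ofReal_mul (mul_nonneg (le_max_left _ _) (hFnn x hx0)),
        ENNReal.ofReal_mul (le_max_left _ _), mul_comm]
    · rw [indicator_of_notMem (s := Ioi t) (by simpa using hx)]
      simp [indicator, hx]
  rw [eL2]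
  have eU : Ioi t = ⋃ k : ℕ, Ioc t (t + k) := by
    ext x
    simp only [mem_Ioi, mem_iUnion, mem_Ioc]
    constructor
    · intro h
      obtain ⟨k, hk⟩ := exists_nat_ge (x - t)
      exact ⟨k, h, by linarith⟩
    · rintro ⟨k, h, _⟩
      exact h
  rw [eU, setLIntegral_iUnion_of_directed]
  swap
  · apply directed_of_isDirected_le
    intro a b hab
    apply Ioc_subset_Ioc_right
    have : (a:ℝ) ≤ b := by exact_mod_cast hab
    linarith
  apply iSup_le
  intro k
  have hT : t ≤ t + k := by have : (0:ℝ) ≤ k := by positivity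
                            linarith
  have hT0 : 0 ≤ t + k := ht.trans hT
  have main := oneDim_aux F f ψ hf hpos hF hψ hreg hF1 t (t + k) ht hT
  have hψc : ContinuousOn ψ (Ici 0) := by
    have : ψ = fun x => x - (1 - F x) / f x := funext hψ
    rw [this]
    exact continuousOn_id.sub (((continuous_const.sub hFc).continuousOn).div hf.continuousOn
      fun x hx => (hpos x hx).ne')
  have hg2c : ContinuousOn (fun x => max 0 (ψ x) * F x * f x) (Ici 0) :=
    ((continuousOn_const.sup hψc).mul hFc.continuousOn).mul hf.continuousOn
  have hg1c : Continuous fun y => (max y t * (1 - F (max y t))) * f y := by fun_prop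
  rw [intervalIntegral.integral_of_le hT, intervalIntegral.integral_of_le hT0] at main
  have main2 := ENNReal.ofReal_le_ofReal main
  rw [ENNReal.ofReal_mul (by norm_num), ofReal_integral_eq_lintegral_ofReal,
    ofReal_integral_eq_lintegral_ofReal] at main2
  · refine main2.trans ?_
    rw [ENNReal.ofReal_ofNat]
    refine mul_le_mul' le_rfl ?_
    refine (lintegral_mono_set (show Ioc 0 (t + k) ⊆ Ici 0 from fun x hx => hx.1.le)).trans ?_
    apply setLIntegral_mono' measurableSet_Ici
    intro x hx
    have h0 : 0 ≤ max x t := le_max_of_le_right ht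
    rw [ENNReal.ofReal_mul (mul_nonneg h0 (sub_nonneg.2 (hF1 _ h0))), mul_comm]
  · exact (hg1c.integrableOn_Icc (a := 0) (b := t + k)).mono_set Ioc_subset_Icc_self
  · filter_upwards [ae_restrict_mem measurableSet_Ioc] with x hx
    have h0 : 0 ≤ max x t := le_max_of_le_right ht
    exact mul_nonneg (mul_nonneg h0 (sub_nonneg.2 (hF1 _ h0))) (hpos x hx.1.le).le
  · exact ((hg2c.mono fun x hx => ht.trans hx.1).integrableOn_Icc (a := t) (b := t + k)).mono_set
      Ioc_subset_Icc_self
  · filter_upwards [ae_restrict_mem measurableSet_Ioc] with x hx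
    have hx0 : 0 ≤ x := ht.trans hx.1.le
    exact mul_nonneg (mul_nonneg (le_max_left _ _) (hFnn x hx0)) (hpos x hx0).le

/-- The (nonnegative part of the) highest value in `s`. -/
noncomputable def topOf {ι : Type*} (s : Finset ι) (z : ι → ℝ) : ℝ :=
  ((s.sup fun c => (z c).toNNReal : NNReal) : ℝ)

theorem measurable_sup_toNNReal {ι : Type*} (s : Finset ι) :
    Measurable fun z : ι → ℝ => (s.sup fun c => (z c).toNNReal) := by
  classical
  induction s using Finset.induction_on with
  | empty => simp
  | insert a s _ ih =>
    simp only [Finset.sup_insert]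
    exact Measurable.sup (measurable_real_toNNReal.comp (measurable_pi_apply a)) ih

theorem measurable_topOf {ι : Type*} (s : Finset ι) : Measurable (topOf s) :=
  measurable_coe_nnreal_real.comp (measurable_sup_toNNReal s)

theorem topOf_nonneg {ι : Type*} (s : Finset ι) (z : ι → ℝ) : 0 ≤ topOf s z := NNReal.coe_nonneg _

theorem le_topOf {ι : Type*} (s : Finset ι) (z : ι → ℝ) (c : ι) (hc : c ∈ s) :
    z c ≤ topOf s z :=
  (Real.le_coe_toNNReal _).trans
    (NNReal.coe_le_coe.2 (Finset.le_sup (f := fun c => (z c).toNNReal) hc))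

theorem topOf_le {ι : Type*} (s : Finset ι) (z : ι → ℝ) (B : ℝ) (hB : 0 ≤ B)
    (h : ∀ c ∈ s, z c ≤ B) : topOf s z ≤ B := by
  have : (s.sup fun c => (z c).toNNReal) ≤ B.toNNReal :=
    Finset.sup_le fun c hc => Real.toNNReal_le_toNNReal (h c hc)
  have h2 := NNReal.coe_le_coe.2 this
  rwa [Real.coe_toNNReal _ hB] at h2

theorem topOf_lt {ι : Type*} (s : Finset ι) (z : ι → ℝ) (B : ℝ) (hB : 0 < B)
    (h : ∀ c ∈ s, z c < B) : topOf s z < B := by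
  have : (s.sup fun c => (z c).toNNReal) < B.toNNReal := by
    rw [Finset.sup_lt_iff (by simpa using hB)]
    exact fun c hc => (Real.toNNReal_lt_toNNReal_iff hB).2 (h c hc)
  have h2 := NNReal.coe_lt_coe.2 this
  rwa [Real.coe_toNNReal _ hB.le] at h2

theorem law_pair_top {ι : Type*} [Fintype ι] [DecidableEq ι] (ν : ι → Measure ℝ)
    [∀ i, IsProbabilityMeasure (ν i)] (a b : ι) (hab : a ≠ b) (s : Finset ι)
    (has : a ∉ s) (hbs : b ∉ s) :
    (Measure.pi ν).map (fun z => ((z a, z b), topOf s z))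
      = ((ν a).prod (ν b)).prod ((Measure.pi ν).map (topOf s)) := by
  have hI : ProbabilityTheory.iIndepFun (fun i (z : ι → ℝ) => z i) (Measure.pi ν) :=
    ProbabilityTheory.iIndepFun_pi (X := fun _ x => x) fun _ => aemeasurable_id
  have h1 := hI.indepFun_finset {a, b} s (by simp [has, hbs])
    (fun i => measurable_pi_apply i)
  have h2 := h1.comp (φ := fun w : (({a, b} : Finset ι) → ℝ) =>
      (w ⟨a, by simp⟩, w ⟨b, by simp⟩)) (ψ := topOf s.attach ∘ id)
    (by fun_prop) ((measurable_topOf _).comp measurable_id)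
  have e : (topOf s.attach ∘ id) ∘ (fun (z : ι → ℝ) (i : s) => z i) = topOf s := by
    funext z
    simp only [topOf, Function.comp, id]
    rw [Finset.sup_attach s (fun c => (z c).toNNReal)]
  rw [e] at h2
  have h3 := hI.indepFun hab
  rw [ProbabilityTheory.indepFun_iff_map_prod_eq_prod_map_map
    (measurable_pi_apply a).aemeasurable (measurable_pi_apply b).aemeasurable] at h3
  rw [ProbabilityTheory.indepFun_iff_map_prod_eq_prod_map_map
    (by exact Measurable.aemeasurable (by fun_prop)) (measurable_topOf s).aemeasurable] at h2
  have ea : (Measure.pi ν).map (fun z => z a) = ν a := (measurePreserving_eval ν a).map_eq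
  have eb : (Measure.pi ν).map (fun z => z b) = ν b := (measurePreserving_eval ν b).map_eq
  rw [ea, eb] at h3
  rw [← h3]
  exact h2

theorem min_le_secondHighest {ι : Type*} [Fintype ι] [DecidableEq ι]
    (h : 2 ≤ Fintype.card ι) (x : ι → ℝ) (a c : ι) (hac : c ≠ a) :
    min (x a) (x c) ≤ secondHighest h x := by
  unfold secondHighest
  refine le_trans ?_ (Finset.le_sup' _ (Finset.mem_univ a))
  exact min_le_min le_rfl (Finset.le_sup' x (Finset.mem_erase.2 ⟨hac, Finset.mem_univ c⟩))

theorem secondHighest_le_sum {ι : Type*} [Fintype ι] [DecidableEq ι]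
    (h : 2 ≤ Fintype.card ι) (x : ι → ℝ) (hx : ∀ i, 0 ≤ x i) :
    secondHighest h x ≤ ∑ i, x i := by
  unfold secondHighest
  refine Finset.sup'_le _ _ fun i _ => (min_le_left _ _).trans ?_
  exact Finset.single_le_sum (fun i _ => hx i) (Finset.mem_univ i)

theorem measurable_sup'_fun {ι δ : Type*} [MeasurableSpace δ] (s : Finset ι) (hs : s.Nonempty)
    (g : ι → δ → ℝ) (hg : ∀ i, Measurable (g i)) :
    Measurable fun x => s.sup' hs fun i => g i x := by
  have e : (fun x => s.sup' hs fun i => g i x) = s.sup' hs g := by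
    funext x
    exact (Finset.sup'_apply hs g x).symm
  rw [e]
  exact Finset.measurable_sup' hs fun i _ => hg i

theorem measurable_secondHighest {ι : Type*} [Fintype ι] [DecidableEq ι]
    (h : 2 ≤ Fintype.card ι) : Measurable (secondHighest (ι := ι) h) := by
  unfold secondHighest
  refine measurable_sup'_fun Finset.univ _ (fun i (x : ι → ℝ) => min (x i)
    ((Finset.univ.erase i).sup' _ x)) fun i => (measurable_pi_apply i).min ?_
  exact measurable_sup'_fun _ _ (fun i (x : ι → ℝ) => x i) fun i => measurable_pi_apply i

/-- Index set excluding the pair `j`. -/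
def othersOf {n : ℕ} (j : Fin n) : Finset (Fin n ⊕ Fin n) :=
  (Finset.univ.erase (Sum.inl j)).erase (Sum.inr j)

theorem mem_othersOf {n : ℕ} (j : Fin n) (c : Fin n ⊕ Fin n) :
    c ∈ othersOf j ↔ c ≠ Sum.inl j ∧ c ≠ Sum.inr j := by
  simp [othersOf, and_comm]

/-- The payment collected by bidder `a` with duplicate `b` when everyone else is in `s`. -/
noncomputable def payOf {ι : Type*} (s : Finset ι) (a b : ι) (z : ι → ℝ) : ENNReal :=
  if max (z b) (topOf s z) < z a then ENNReal.ofReal (max (z b) (topOf s z)) else 0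

theorem measurable_payOf {ι : Type*} (s : Finset ι) (a b : ι) : Measurable (payOf s a b) := by
  have := measurable_topOf s
  exact Measurable.ite (measurableSet_lt (by fun_prop) (by fun_prop)) (by fun_prop)
    measurable_const

theorem sum_pay_le {n : ℕ} (h : 2 ≤ Fintype.card (Fin n ⊕ Fin n)) (z : Fin n ⊕ Fin n → ℝ)
    (hz : ∀ i, 0 ≤ z i) :
    ∑ j, (payOf (othersOf j) (Sum.inl j) (Sum.inr j) z
        + payOf (othersOf j) (Sum.inr j) (Sum.inl j) z)
      ≤ ENNReal.ofReal (secondHighest h z) := by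
  classical
  rw [Finset.sum_add_distrib]
  let P : Fin n ⊕ Fin n → ENNReal := fun a => Sum.elim
    (fun j => payOf (othersOf j) (Sum.inl j) (Sum.inr j) z)
    (fun j => payOf (othersOf j) (Sum.inr j) (Sum.inl j) z) a
  have e : ∑ j, payOf (othersOf j) (Sum.inl j) (Sum.inr j) z
        + ∑ j, payOf (othersOf j) (Sum.inr j) (Sum.inl j) z = ∑ a, P a := by
    rw [Fintype.sum_sum_type]; rfl
  rw [e]
  have gen : ∀ (s : Finset (Fin n ⊕ Fin n)) (a b : Fin n ⊕ Fin n), a ≠ b →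
      (∀ c, c ∈ s ↔ c ≠ a ∧ c ≠ b) → payOf s a b z ≠ 0 →
      (∀ c, c ≠ a → z c < z a) ∧ payOf s a b z ≤ ENNReal.ofReal (secondHighest h z) := by
    intro s a b hab hs hne
    unfold payOf at hne ⊢
    split_ifs at hne ⊢ with hlt
    · have hall : ∀ c, c ≠ a → z c < z a := by
        intro c hc
        refine lt_of_le_of_lt ?_ hlt
        by_cases hcb : c = b
        · rw [hcb]; exact le_max_left _ _
        · exact le_max_of_le_right (le_topOf s z c ((hs c).2 ⟨hc, hcb⟩))
      refine ⟨hall, ENNReal.ofReal_le_ofReal ?_⟩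
      have hc : ∀ c, c ≠ a → z c ≤ secondHighest h z := by
        intro c hc
        have := min_le_secondHighest h z a c hc
        rwa [min_eq_right (hall c hc).le] at this
      have hb := hc b hab.symm
      exact max_le hb (topOf_le s z _ ((hz b).trans hb) fun c hcs => hc c ((hs c).1 hcs).1)
    · exact absurd rfl hne
  have hP : ∀ a, P a ≠ 0 → (∀ c, c ≠ a → z c < z a)
      ∧ P a ≤ ENNReal.ofReal (secondHighest h z) := by
    rintro (j | j) hne
    · exact gen _ _ _ (by simp) (mem_othersOf j) hne
    · exact gen _ _ _ (by simp) (fun c => (mem_othersOf j c).trans and_comm) hne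
  by_cases hex : ∃ a, P a ≠ 0
  · obtain ⟨a, ha⟩ := hex
    rw [Finset.sum_eq_single a]
    · exact (hP a ha).2
    · intro b _ hba
      by_contra hb
      exact lt_asymm ((hP a ha).1 b hba) ((hP b hb).1 a hba.symm)
    · simp
  · push Not at hex
    simp [hex]

/-- Virtual value of `inl j` when it beats everyone else. -/
noncomputable def virtOf {ι : Type*} (s : Finset ι) (a b : ι) (ψ : ℝ → ℝ) (z : ι → ℝ) : ENNReal :=
  if max (z b) (topOf s z) < z a then ENNReal.ofReal (max 0 (ψ (z a))) else 0

theorem measurable_virtOf {ι : Type*} (s : Finset ι) (a b : ι) (ψ : ℝ → ℝ) (hψ : Measurable ψ) :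
    Measurable (virtOf s a b ψ) := by
  have := measurable_topOf s
  exact Measurable.ite (measurableSet_lt (by fun_prop) (by fun_prop)) (by fun_prop)
    measurable_const

theorem virt_le_pay {ι : Type*} [Fintype ι] [DecidableEq ι] (ν : ι → Measure ℝ)
    [∀ i, IsProbabilityMeasure (ν i)] (a b : ι) (hab : a ≠ b) (s : Finset ι)
    (has : a ∉ s) (hbs : b ∉ s)
    (F f ψ : ℝ → ℝ) (hf : Continuous f) (hpos : ∀ x, 0 ≤ x → 0 < f x)
    (hF : ∀ x, F x = ∫ t in (0:ℝ)..x, f t)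
    (hψ : ∀ x, ψ x = x - (1 - F x) / f x)
    (hreg : StrictMonoOn ψ (Ici 0)) (hψm : Measurable ψ)
    (hp : IsProbabilityMeasure (valueMeasure f))
    (hνa : ν a = valueMeasure f) (hνb : ν b = valueMeasure f) :
    ∫⁻ z, virtOf s a b ψ z ∂(Measure.pi ν)
      ≤ ∫⁻ z, (payOf s a b z + payOf s b a z) ∂(Measure.pi ν) := by
  have hmT := measurable_topOf s
  have hset : MeasurableSet {p : (ℝ × ℝ) × ℝ | max p.1.2 p.2 < p.1.1} :=
    measurableSet_lt (by fun_prop) (by fun_prop)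
  have hm1 : Measurable fun p : (ℝ × ℝ) × ℝ =>
      (if max p.1.2 p.2 < p.1.1 then ENNReal.ofReal (max 0 (ψ p.1.1)) else 0) :=
    Measurable.ite hset (by fun_prop) measurable_const
  have hm2 : Measurable fun p : (ℝ × ℝ) × ℝ =>
      (if max p.1.2 p.2 < p.1.1 then ENNReal.ofReal (max p.1.2 p.2) else 0) :=
    Measurable.ite hset (by fun_prop) measurable_const
  have l1 := law_pair_top ν a b hab s has hbs
  have l2 := law_pair_top ν b a hab.symm s hbs has
  rw [hνa, hνb] at l1 l2
  set L := (Measure.pi ν).map (topOf s) with hL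
  have hLp : IsProbabilityMeasure L := Measure.isProbabilityMeasure_map hmT.aemeasurable
  have e1 : ∫⁻ z, virtOf s a b ψ z ∂(Measure.pi ν) = ∫⁻ p, (if max p.1.2 p.2 < p.1.1 then
      ENNReal.ofReal (max 0 (ψ p.1.1)) else 0)
      ∂(((valueMeasure f).prod (valueMeasure f)).prod L) := by
    rw [← l1, lintegral_map hm1 (by fun_prop)]; rfl
  have e2 : ∫⁻ z, payOf s a b z ∂(Measure.pi ν) = ∫⁻ p, (if max p.1.2 p.2 < p.1.1 then
      ENNReal.ofReal (max p.1.2 p.2) else 0)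
      ∂(((valueMeasure f).prod (valueMeasure f)).prod L) := by
    rw [← l1, lintegral_map hm2 (by fun_prop)]; rfl
  have e3 : ∫⁻ z, payOf s b a z ∂(Measure.pi ν) = ∫⁻ p, (if max p.1.2 p.2 < p.1.1 then
      ENNReal.ofReal (max p.1.2 p.2) else 0)
      ∂(((valueMeasure f).prod (valueMeasure f)).prod L) := by
    rw [← l2, lintegral_map hm2 (by fun_prop)]; rfl
  rw [lintegral_add_left (measurable_payOf s a b), e1, e2, e3, ← two_mul,
    lintegral_prod_symm _ hm1.aemeasurable, lintegral_prod_symm _ hm2.aemeasurable,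
    ← lintegral_const_mul _ hm2.lintegral_prod_left']
  apply lintegral_mono_ae
  have hL0 : ∀ᵐ t ∂L, 0 ≤ t :=
    (ae_map_iff hmT.aemeasurable measurableSet_Ici).2
      (Filter.Eventually.of_forall fun z => topOf_nonneg s z)
  filter_upwards [hL0] with t ht
  exact oneDim_lintegral F f ψ hf hpos hF hψ hreg hψm hp t ht

/-- **Duplicating the bidders: Vickrey with `2n` bidders 2-approximates Myerson with `n`.**
Let `X₁,…,Xₙ` be independent with regular cdfs `Fᵢ` (virtual values `ψᵢ`) and let
`Y₁,…,Yₙ` be independent copies.  The second-price auction without reserve on the `2n`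
bidders earns `E[second-highest of (X₁,…,Xₙ,Y₁,…,Yₙ)]`, which is at least half the Myerson
revenue `E[max(0, maxᵢ ψᵢ(Xᵢ))]` on the `n` original bidders. -/
theorem vickrey_with_duplicates_half_of_myerson
    (n : ℕ) (hn : 1 ≤ n)
    (F f ψ : Fin n → ℝ → ℝ)
    (hf_cont : ∀ i, Continuous (f i))
    (hf_pos : ∀ i x, 0 ≤ x → 0 < f i x)
    (hF : ∀ i x, F i x = ∫ t in (0:ℝ)..x, f i t)
    (hψ : ∀ i x, ψ i x = x - (1 - F i x) / f i x)
    (hreg : ∀ i, StrictMonoOn (ψ i) (Ici 0))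
    (μ : Fin n → Measure ℝ) (hμ : ∀ i, μ i = valueMeasure (f i))
    (hprob : ∀ i, IsProbabilityMeasure (μ i))
    (hexp : ∀ i, Integrable (fun x => x) (μ i)) :
    (1 / 2 : ℝ) *
        (∫ x : Fin n → ℝ,
          max 0 (Finset.univ.sup' ⟨⟨0, by omega⟩, Finset.mem_univ _⟩ fun i => ψ i (x i))
          ∂Measure.pi μ)
      ≤ ∫ x : (Fin n ⊕ Fin n) → ℝ,
          secondHighest (by simp [Fintype.card_sum]; omega) x
          ∂(Measure.pi (Sum.elim μ μ)) := by
  classical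
  have hFc : ∀ i, Continuous (F i) := by
    intro i
    rw [show F i = _ from funext (hF i)]
    exact intervalIntegral.continuous_primitive (fun a b => (hf_cont i).intervalIntegrable a b) 0
  have hψm : ∀ i, Measurable (ψ i) := by
    intro i
    rw [show ψ i = _ from funext (hψ i)]
    exact measurable_id.sub ((measurable_const.sub (hFc i).measurable).div (hf_cont i).measurable)
  have hp' : ∀ i, IsProbabilityMeasure (valueMeasure (f i)) := fun i => hμ i ▸ hprob i
  have hprob2 : ∀ a, IsProbabilityMeasure (Sum.elim μ μ a) := by
    rintro (i | i) <;> exact hprob i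
  have hcard : 2 ≤ Fintype.card (Fin n ⊕ Fin n) := by simp [Fintype.card_sum]; omega
  set ν : Fin n ⊕ Fin n → Measure ℝ := Sum.elim μ μ with hν
  have hz0 : ∀ᵐ z ∂(Measure.pi ν), ∀ a, 0 ≤ z a := by
    rw [Filter.eventually_all]
    intro a
    refine Measure.tendsto_eval_ae_ae.eventually (p := fun x : ℝ => 0 ≤ x) ?_
    rcases a with i | i
    · change ∀ᵐ x ∂(μ i), 0 ≤ x
      rw [hμ]; exact valueMeasure_ae_nonneg _
    · change ∀ᵐ x ∂(μ i), 0 ≤ x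
      rw [hμ]; exact valueMeasure_ae_nonneg _
  let M : (Fin n → ℝ) → ℝ := fun x =>
    max 0 (Finset.univ.sup' ⟨⟨0, by omega⟩, Finset.mem_univ _⟩ fun i => ψ i (x i))
  have hMm : Measurable M := by
    exact measurable_const.max (measurable_sup'_fun Finset.univ _
      (fun i (x : Fin n → ℝ) => ψ i (x i)) fun i => (hψm i).comp (measurable_pi_apply i))
  have hM0 : ∀ x, 0 ≤ M x := fun x => le_max_left _ _
  have hS0 : ∀ z : Fin n ⊕ Fin n → ℝ, (∀ a, 0 ≤ z a) → 0 ≤ secondHighest hcard z := by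
    intro z hz
    exact (le_min (hz _) (hz _)).trans
      (min_le_secondHighest hcard z (Sum.inl ⟨0, by omega⟩) (Sum.inr ⟨0, by omega⟩) (by simp))
  have hSm := measurable_secondHighest hcard
  have hψle : ∀ i x, 0 ≤ x → ψ i x ≤ x := by
    intro i x hx
    have h1 := valueMeasure_cdf_le (F i) (f i) (hf_cont i) (hf_pos i) (hF i) (hp' i) x hx
    have h2 := div_nonneg (sub_nonneg.2 h1) (hf_pos i x hx).le
    rw [hψ]; linarith
  have hSint : Integrable (fun z => secondHighest hcard z) (Measure.pi ν) := by
    have hsum : Integrable (fun z : Fin n ⊕ Fin n → ℝ => ∑ a, z a) (Measure.pi ν) := by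
      refine integrable_finsetSum _ fun a _ => ?_
      have hmp := measurePreserving_eval ν a
      have : Integrable (fun x : ℝ => x) (ν a) := by
        rcases a with i | i <;> exact hexp i
      exact hmp.integrable_comp_of_integrable this
    refine hsum.mono' hSm.aestronglyMeasurable ?_
    filter_upwards [hz0] with z hz
    rw [Real.norm_of_nonneg (hS0 z hz)]
    exact secondHighest_le_sum hcard z hz
  -- pointwise bound on the Myerson revenue
  have hpt : ∀ z : Fin n ⊕ Fin n → ℝ, (∀ a, 0 ≤ z a) →
      ENNReal.ofReal (M fun i => z (Sum.inl i)) ≤ ENNReal.ofReal (secondHighest hcard z)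
        + ∑ j, virtOf (othersOf j) (Sum.inl j) (Sum.inr j) (ψ j) z := by
    intro z hz
    obtain ⟨i, _, hi⟩ := Finset.exists_mem_eq_sup' (s := (Finset.univ : Finset (Fin n)))
      ⟨⟨0, by omega⟩, Finset.mem_univ _⟩ fun i => ψ i (z (Sum.inl i))
    have hMi : M (fun i => z (Sum.inl i)) = max 0 (ψ i (z (Sum.inl i))) := by
      simp only [M]; rw [hi]
    rw [hMi]
    by_cases htop : ∀ c, c ≠ Sum.inl i → z c < z (Sum.inl i)
    · refine le_add_of_nonneg_of_le zero_le ?_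
      refine le_trans ?_ (Finset.single_le_sum (fun _ _ => zero_le) (Finset.mem_univ i))
      have hb := htop (Sum.inr i) (by simp)
      have hlt : max (z (Sum.inr i)) (topOf (othersOf i) z) < z (Sum.inl i) :=
        max_lt hb (topOf_lt _ _ _ ((hz _).trans_lt hb)
          fun c hc => htop c ((mem_othersOf i c).1 hc).1)
      rw [virtOf, if_pos hlt]
    · push Not at htop
      obtain ⟨c, hc, hle⟩ := htop
      refine le_add_of_le_of_nonneg (ENNReal.ofReal_le_ofReal ?_) zero_le
      refine max_le (hS0 z hz) ((hψle i _ (hz _)).trans ?_)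
      have := min_le_secondHighest hcard z _ c hc
      rwa [min_eq_left hle] at this
  have hmp : MeasurePreserving (fun (z : Fin n ⊕ Fin n → ℝ) (i : Fin n) => z (Sum.inl i))
      (Measure.pi ν) (Measure.pi μ) := by
    have h1 := measurePreserving_sumPiEquivProdPi ν
    exact (measurePreserving_fst (μ := Measure.pi fun i => ν (Sum.inl i))
      (ν := Measure.pi fun i => ν (Sum.inr i))).comp h1
  have hmain : ∫⁻ x, ENNReal.ofReal (M x) ∂(Measure.pi μ)
      ≤ 2 * ∫⁻ z, ENNReal.ofReal (secondHighest hcard z) ∂(Measure.pi ν) := by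
    rw [← hmp.lintegral_comp (f := fun x => ENNReal.ofReal (M x)) (by fun_prop), two_mul]
    calc _ ≤ ∫⁻ z, (ENNReal.ofReal (secondHighest hcard z)
        + ∑ j, virtOf (othersOf j) (Sum.inl j) (Sum.inr j) (ψ j) z) ∂(Measure.pi ν) :=
          lintegral_mono_ae (hz0.mono hpt)
      _ = ∫⁻ z, ENNReal.ofReal (secondHighest hcard z) ∂(Measure.pi ν)
        + ∑ j, ∫⁻ z, virtOf (othersOf j) (Sum.inl j) (Sum.inr j) (ψ j) z ∂(Measure.pi ν) := by
          rw [lintegral_add_left (by fun_prop),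
            lintegral_finsetSum _ fun j _ => measurable_virtOf _ _ _ _ (hψm j)]
      _ ≤ ∫⁻ z, ENNReal.ofReal (secondHighest hcard z) ∂(Measure.pi ν)
        + ∑ j, ∫⁻ z, (payOf (othersOf j) (Sum.inl j) (Sum.inr j) z
          + payOf (othersOf j) (Sum.inr j) (Sum.inl j) z) ∂(Measure.pi ν) := by
          refine add_le_add le_rfl (Finset.sum_le_sum fun j _ => ?_)
          exact virt_le_pay ν _ _ (by simp) _ (by simp [mem_othersOf]) (by simp [mem_othersOf])
            (F j) (f j) (ψ j) (hf_cont j) (hf_pos j) (hF j) (hψ j) (hreg j) (hψm j) (hp' j)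
            (hμ j) (hμ j)
      _ ≤ _ := by
          refine add_le_add le_rfl ?_
          rw [← lintegral_finsetSum Finset.univ (f := fun j z =>
            payOf (othersOf j) (Sum.inl j) (Sum.inr j) z
              + payOf (othersOf j) (Sum.inr j) (Sum.inl j) z) fun j _ =>
            (measurable_payOf _ _ _).add (measurable_payOf _ _ _)]
          exact lintegral_mono_ae (hz0.mono fun z hz => sum_pay_le hcard z hz)
  have hS0' : 0 ≤ᵐ[Measure.pi ν] fun z => secondHighest hcard z := hz0.mono hS0
  rw [← ofReal_integral_eq_lintegral_ofReal hSint hS0'] at hmain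
  have hSi : 0 ≤ ∫ z, secondHighest hcard z ∂(Measure.pi ν) := integral_nonneg_of_ae hS0'
  have hfin : ∫ x, M x ∂(Measure.pi μ) ≤ 2 * ∫ z, secondHighest hcard z ∂(Measure.pi ν) := by
    rw [integral_eq_lintegral_of_nonneg_ae (Filter.Eventually.of_forall hM0)
      hMm.aestronglyMeasurable]
    have := ENNReal.toReal_mono (ENNReal.mul_ne_top (by simp) ENNReal.ofReal_ne_top) hmain
    rwa [ENNReal.toReal_mul, ENNReal.toReal_ofReal hSi, ENNReal.toReal_ofNat] at this
  change (1 / 2 : ℝ) * (∫ x, M x ∂(Measure.pi μ)) ≤ ∫ z, secondHighest hcard z ∂(Measure.pi ν)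
  linarith
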